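/- arXiv:math/0506207 — 2 statements merged into one kernel-verified Lean document; each statement's English description precedes it below -/
import Mathlib

section
/- For each natural number k ≥ 1 and every real x > k − 2 with x ∉ {−1, 0, 1, …, k−2}, one has Σ_{i=0}^{k−1} (−1)^{k+i}·Γ(x+1−i) = Γ(x+2)·r_k(x). -/
/-- The rational functions `rₙ` (real version): `r₁(z) = −1/(z+1)`, `r₂(z) = (z−1)/(z(z+1))`,
and `rₙ(z) = −((z−n+1)/(z−n+2))·rₙ₋₁(z) + (1/(z−n+2))·rₙ₋₂(z)` for `n ≥ 3`.
(The value of `r₀` is an irrelevant junk value.) -/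
noncomputable def kurepaR : ℕ → ℝ → ℝ
  | 0, _ => 0
  | 1, z => -1 / (z + 1)
  | 2, z => (z - 1) / (z * (z + 1))
  | (n + 3), z =>
      -((z - ((n : ℝ) + 3) + 1) / (z - ((n : ℝ) + 3) + 2)) * kurepaR (n + 2) z +
        (1 / (z - ((n : ℝ) + 3) + 2)) * kurepaR (n + 1) z

/-- Peeling off the last term of the alternating Gamma sum. -/
lemma alternating_gamma_sum_succ (k : ℕ) (x : ℝ) :
    ∑ i ∈ Finset.range (k + 1), (-1 : ℝ) ^ (k + 1 + i) * Real.Gamma (x + 1 - (i : ℝ)) =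
      -∑ i ∈ Finset.range k, (-1 : ℝ) ^ (k + i) * Real.Gamma (x + 1 - (i : ℝ)) -
        Real.Gamma (x + 1 - (k : ℝ)) := by
  have hsign : (-1 : ℝ) ^ (k + 1 + k) = -1 := Odd.neg_one_pow ⟨k, by ring⟩
  rw [Finset.sum_range_succ, hsign, ← Finset.sum_neg_distrib, neg_one_mul, ← sub_eq_add_neg]
  congr 1
  refine Finset.sum_congr rfl fun i _ => ?_
  ring

/-- The identity for every `k ≥ 1` and `x > k - 2`, with the index shifted by one. -/
lemma alternating_gamma_sum_succ_eq (x : ℝ) : ∀ k : ℕ, (k : ℝ) - 1 < x →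
    ∑ i ∈ Finset.range (k + 1), (-1 : ℝ) ^ (k + 1 + i) * Real.Gamma (x + 1 - (i : ℝ)) =
      Real.Gamma (x + 2) * kurepaR (k + 1) x
  | 0, hx => by
    have h : x + 1 ≠ 0 := by push_cast at hx; linarith
    have hG : Real.Gamma (x + 2) = (x + 1) * Real.Gamma (x + 1) := by
      rw [← Real.Gamma_add_one h]; ring_nf
    simp only [zero_add, Finset.sum_range_one, kurepaR, hG, Nat.cast_zero, sub_zero]
    field_simp
    norm_num
  | 1, hx => by
    have h0 : x ≠ 0 := by push_cast at hx; linarith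
    have h1 : x + 1 ≠ 0 := by push_cast at hx; linarith
    have hG : Real.Gamma (x + 2) = (x + 1) * Real.Gamma (x + 1) := by
      rw [← Real.Gamma_add_one h1]; ring_nf
    simp only [Nat.reduceAdd, Finset.sum_range_succ, Finset.sum_range_zero, kurepaR, hG,
      Real.Gamma_add_one h0, Nat.cast_zero, Nat.cast_one, sub_zero, add_sub_cancel_right]
    field_simp
    ring
  | n + 2, hx => by
    push_cast at hx
    have h : x - ((n : ℝ) + 3) + 2 ≠ 0 := by linarith
    have ih₁ := alternating_gamma_sum_succ_eq x n (by linarith)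
    have ih₂ := alternating_gamma_sum_succ_eq x (n + 1) (by push_cast; linarith)
    have hS₂ := alternating_gamma_sum_succ (n + 1) x
    have hS₃ := alternating_gamma_sum_succ (n + 2) x
    have hG : Real.Gamma (x + 1 - ((n + 1 : ℕ) : ℝ)) =
        (x - ((n : ℝ) + 3) + 2) * Real.Gamma (x + 1 - ((n + 2 : ℕ) : ℝ)) := by
      have h' : x + 1 - ((n + 2 : ℕ) : ℝ) = x - ((n : ℝ) + 3) + 2 := by push_cast; ring
      rw [h', ← Real.Gamma_add_one h]
      congr 1
      push_cast
      ring
    rw [ih₁, ih₂, hG] at hS₂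
    rw [hS₃, ih₂]
    simp only [kurepaR]
    simp only [Nat.reduceAdd, add_assoc] at hS₂ ⊢
    field_simp
    linear_combination -hS₂

/-- For each `k ≥ 1` and every real `x > k − 2` with `x ∉ {−1, 0, 1, …, k−2}`,
`Σ_{i=0}^{k−1} (−1)^{k+i}·Γ(x+1−i) = Γ(x+2)·r_k(x)`. -/
theorem alternating_gamma_sum_eq_gamma_mul_kurepaR (k : ℕ) (hk : 1 ≤ k) (x : ℝ)
    (hx : (k : ℝ) - 2 < x) (hx' : ∀ m : ℤ, -1 ≤ m → m ≤ (k : ℤ) - 2 → x ≠ (m : ℝ)) :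
    ∑ i ∈ Finset.range k, (-1 : ℝ) ^ (k + i) * Real.Gamma (x + 1 - (i : ℝ)) =
      Real.Gamma (x + 2) * kurepaR k x := by
  obtain ⟨k, rfl⟩ := Nat.exists_eq_add_of_le' hk
  exact alternating_gamma_sum_succ_eq x k (by push_cast at hx; linarith)
end

section
/- For each fixed odd natural number k = 2n+1 (n ≥ 0) and every real x ≥ k+1, the following double inequality holds: (p_k(x)/(p_k(x)+1))·(−r_k(x)) ≤ F(x)/Γ(x+2) < −r_k(x), where the left inequality is an equality if and only if x = k+1. -/
open MeasureTheory

/-- The real part of the alternating Kurepa function: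
`F(x) = ∫₀^∞ e^{−t} (t^{x+1} − cos(πx)·t)/(t+1) dt`, convergent for `x > −2`. -/
noncomputable def reAltKurepa (x : ℝ) : ℝ :=
  ∫ t in Set.Ioi (0 : ℝ), Real.exp (-t) * (t ^ (x + 1) - Real.cos (Real.pi * x) * t) / (t + 1)

/-- The polynomials `pₙ` (real version), defined recursively by `p₀(z) = 1` and
`pₙ(z) = (z − n + 1)·pₙ₋₁(z) + (−1)ⁿ` for `n ≥ 1`. -/
noncomputable def kurepaP : ℕ → ℝ → ℝ
  | 0, _ => 1
  | (n + 1), z => (z - ((n : ℝ) + 1) + 1) * kurepaP n z + (-1 : ℝ) ^ (n + 1)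

/-- A Laurent polynomial lower bound for `log`, touching it at `t = 1`. -/
theorem laurent_le_log {t : ℝ} (ht : 0 < t) :
    -6 / 25 * t⁻¹ - 1033 / 1200 + 913 / 600 * t - 203 / 400 * t ^ 2 + 7 / 75 * t ^ 3
      - 1 / 150 * t ^ 4 ≤ Real.log t := by
  set f : ℝ → ℝ := fun t => Real.log t - (-6 / 25 * t⁻¹ - 1033 / 1200 + 913 / 600 * t
    - 203 / 400 * t ^ 2 + 7 / 75 * t ^ 3 - 1 / 150 * t ^ 4) with hf
  have hderiv : ∀ s : ℝ, 0 < s →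
      HasDerivAt f (2 / 75 * (s - 1) * ((s - 3 / 4) * (s - 4)) ^ 2 / s ^ 2) s := by
    intro s hs
    have h := (Real.hasDerivAt_log hs.ne').sub
      (((((((hasDerivAt_inv hs.ne').const_mul (-6 / 25 : ℝ)).sub_const (1033 / 1200 : ℝ)).add
        ((hasDerivAt_id s).const_mul (913 / 600 : ℝ))).sub
        ((hasDerivAt_pow 2 s).const_mul (203 / 400 : ℝ))).add
        ((hasDerivAt_pow 3 s).const_mul (7 / 75 : ℝ))).sub
        ((hasDerivAt_pow 4 s).const_mul (1 / 150 : ℝ)))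
    refine h.congr_deriv ?_
    field_simp
    push_cast
    ring
  have h1 : f 1 = 0 := by norm_num [hf]
  have h0 : 0 ≤ f t := by
    rcases le_total t 1 with h | h
    · have hanti : AntitoneOn f (Set.Icc t 1) := by
        refine antitoneOn_of_deriv_nonpos (convex_Icc _ _)
          (fun s hs => (hderiv s (ht.trans_le hs.1)).continuousAt.continuousWithinAt) ?_ ?_ <;>
          rw [interior_Icc] <;> intro s hs
        · exact (hderiv s (ht.trans hs.1)).differentiableAt.differentiableWithinAt
        · rw [(hderiv s (ht.trans hs.1)).deriv]
          exact div_nonpos_of_nonpos_of_nonneg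
            (mul_nonpos_of_nonpos_of_nonneg (by linarith [hs.2]) (sq_nonneg _)) (sq_nonneg _)
      exact h1 ▸ hanti (Set.left_mem_Icc.2 h) (Set.right_mem_Icc.2 h) h
    · have hmono : MonotoneOn f (Set.Icc 1 t) := by
        refine monotoneOn_of_deriv_nonneg (convex_Icc _ _)
          (fun s hs => (hderiv s (one_pos.trans_le hs.1)).continuousAt.continuousWithinAt)
          ?_ ?_ <;> rw [interior_Icc] <;> intro s hs
        · exact (hderiv s (one_pos.trans hs.1)).differentiableAt.differentiableWithinAt
        · rw [(hderiv s (one_pos.trans hs.1)).deriv]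
          exact div_nonneg (mul_nonneg (by linarith [hs.1]) (sq_nonneg _)) (sq_nonneg _)
      exact h1 ▸ hmono (Set.left_mem_Icc.2 h) (Set.right_mem_Icc.2 h) h
  exact sub_nonneg.1 h0

/-- Coefficients of a polynomial minorant of `t log t / (t + 1)` on the positive half line whose
integral against `e^{-t}` is positive. -/
noncomputable def minorantCoeff : Fin 10 → ℝ :=
  ![-3832674 / 14938225, -62895821 / 143406960, 329922353 / 239011600, -12001037 / 11950580,
    71758867 / 179258700, -229559 / 2390116, 33759 / 2390116, -2959 / 2390116, 561 / 9560464,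
    -11 / 9560464]

theorem minorant_le {t : ℝ} (ht : 0 < t) :
    ∑ i, minorantCoeff i * t ^ (i : ℕ) ≤ t * Real.log t / (t + 1) := by
  rw [le_div_iff₀ (by positivity)]
  have h := mul_le_mul_of_nonneg_left (laurent_le_log ht) ht.le
  refine le_trans ?_ h
  have hsq := sq_nonneg (120 - 600 * t + 600 * t ^ 2 - 200 * t ^ 3 + 25 * t ^ 4 - t ^ 5)
  rw [← sub_nonneg]
  refine (mul_nonneg (by norm_num : (0 : ℝ) ≤ 11 / 9560464) hsq).trans_eq ?_
  simp only [minorantCoeff, Fin.sum_univ_succ, Fin.sum_univ_zero, Matrix.cons_val_zero,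
    Matrix.cons_val_succ, Fin.val_zero, Fin.val_succ]
  field_simp
  ring

theorem integrableOn_exp_neg_mul_pow (i : ℕ) :
    IntegrableOn (fun t : ℝ => Real.exp (-t) * t ^ i) (Set.Ioi 0) := by
  have h := Real.GammaIntegral_convergent (s := (i : ℝ) + 1) (by positivity)
  simpa using h

theorem integral_exp_neg_mul_pow (i : ℕ) :
    ∫ t in Set.Ioi (0 : ℝ), Real.exp (-t) * t ^ i = (i.factorial : ℝ) := by
  rw [← Real.Gamma_nat_eq_factorial, Real.Gamma_eq_integral (by positivity)]
  simp

theorem integrableOn_minorant :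
    IntegrableOn (fun t : ℝ => Real.exp (-t) * ∑ i, minorantCoeff i * t ^ (i : ℕ))
      (Set.Ioi 0) := by
  simp only [Finset.mul_sum, mul_left_comm (Real.exp _)]
  exact integrable_finsetSum _ fun i _ => (integrableOn_exp_neg_mul_pow i).const_mul _

theorem integral_minorant_pos :
    0 < ∫ t in Set.Ioi (0 : ℝ), Real.exp (-t) * ∑ i, minorantCoeff i * t ^ (i : ℕ) := by
  simp only [Finset.mul_sum, mul_left_comm (Real.exp _)]
  rw [integral_finsetSum _ fun (i : Fin 10) _ =>
    (integrableOn_exp_neg_mul_pow (i : ℕ)).const_mul (minorantCoeff i)]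
  simp only [integral_const_mul, integral_exp_neg_mul_pow]
  simp only [minorantCoeff, Fin.sum_univ_succ, Fin.sum_univ_zero, Matrix.cons_val_zero,
    Matrix.cons_val_succ, Fin.val_zero, Fin.val_succ]
  norm_num [Nat.factorial]

theorem integrableOn_reAltKurepa_integrand {x : ℝ} (hx : -1 < x) :
    IntegrableOn (fun t : ℝ =>
      Real.exp (-t) * (t ^ (x + 1) - Real.cos (Real.pi * x) * t) / (t + 1)) (Set.Ioi 0) := by
  have hpow : IntegrableOn (fun t : ℝ => Real.exp (-t) * t ^ (x + 1)) (Set.Ioi 0) := by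
    simpa using Real.GammaIntegral_convergent (s := x + 2) (by linarith) |>.congr_fun
      (fun t _ => by rw [show x + 2 - 1 = x + 1 by ring]) measurableSet_Ioi
  have hlin := (integrableOn_exp_neg_mul_pow 1).const_mul (Real.cos (Real.pi * x))
  have hmeas : Measurable fun t : ℝ =>
      Real.exp (-t) * (t ^ (x + 1) - Real.cos (Real.pi * x) * t) / (t + 1) := by fun_prop
  refine Integrable.mono (hpow.sub hlin) hmeas.aestronglyMeasurable ?_
  filter_upwards [ae_restrict_mem measurableSet_Ioi] with t ht
  have ht : 0 < t := ht
  rw [norm_div, Pi.sub_apply]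
  refine (div_le_self (norm_nonneg _) ?_).trans_eq (by congr 1; ring)
  rw [Real.norm_of_nonneg (by positivity)]
  linarith

theorem reAltKurepa_add_reAltKurepa_sub_one {x : ℝ} (hx : 0 < x) :
    reAltKurepa x + reAltKurepa (x - 1) = Real.Gamma (x + 1) := by
  unfold reAltKurepa
  rw [← integral_add (integrableOn_reAltKurepa_integrand (by linarith))
    (integrableOn_reAltKurepa_integrand (by linarith)), Real.Gamma_eq_integral (by linarith)]
  refine setIntegral_congr_fun measurableSet_Ioi fun t ht => ?_
  have ht : 0 < t := ht
  have hcos : Real.cos (Real.pi * (x - 1)) = -Real.cos (Real.pi * x) := by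
    rw [mul_sub, mul_one, Real.cos_sub_pi]
  simp only [hcos, sub_add_cancel, add_sub_cancel_right]
  rw [Real.rpow_add_one ht.ne']
  field_simp
  ring

theorem reAltKurepa_zero : reAltKurepa 0 = 0 := by
  simp [reAltKurepa]

theorem reAltKurepa_pos {x : ℝ} (hx : 0 < x) : 0 < reAltKurepa x := by
  refine (mul_pos hx integral_minorant_pos).trans_le ?_
  rw [reAltKurepa, ← integral_const_mul]
  refine setIntegral_mono_on (integrableOn_minorant.const_mul x)
    (integrableOn_reAltKurepa_integrand (by linarith)) measurableSet_Ioi fun t ht => ?_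
  have ht : 0 < t := ht
  have hlog : x * Real.log t ≤ t ^ x - 1 := by
    rw [Real.rpow_def_of_pos ht, mul_comm x]
    linarith [Real.add_one_le_exp (Real.log t * x)]
  have hnum : x * (t * Real.log t) ≤ t ^ (x + 1) - Real.cos (Real.pi * x) * t := by
    rw [Real.rpow_add_one ht.ne']
    nlinarith [Real.cos_le_one (Real.pi * x)]
  calc x * (Real.exp (-t) * ∑ i, minorantCoeff i * t ^ (i : ℕ))
      ≤ x * (Real.exp (-t) * (t * Real.log t / (t + 1))) := by
        gcongr
        exact minorant_le ht
    _ = Real.exp (-t) * (x * (t * Real.log t)) / (t + 1) := by ring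
    _ ≤ _ := by gcongr

theorem reAltKurepa_nonneg {x : ℝ} (hx : 0 ≤ x) : 0 ≤ reAltKurepa x := by
  rcases hx.eq_or_lt with rfl | h
  · exact reAltKurepa_zero.ge
  · exact (reAltKurepa_pos h).le

/-- Iterating the functional equation `F(x) = Γ(x+1) - F(x-1)`. -/
theorem reAltKurepa_eq_kurepaP_mul_Gamma_add (n : ℕ) {x : ℝ} (hx : (n : ℝ) + 1 ≤ x) :
    reAltKurepa x =
      kurepaP n x * Real.Gamma (x - n + 1) + (-1) ^ (n + 1) * reAltKurepa (x - (n + 1)) := by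
  induction n with
  | zero =>
    push_cast at hx
    have h := reAltKurepa_add_reAltKurepa_sub_one (x := x) (by linarith)
    simp only [kurepaP, CharP.cast_eq_zero, sub_zero, zero_add, pow_one]
    linarith
  | succ n ih =>
    push_cast at hx ⊢
    have h := reAltKurepa_add_reAltKurepa_sub_one (x := x - (n + 1)) (by linarith)
    have hG := Real.Gamma_add_one (s := x - (n + 1) + 1) (by linarith)
    rw [show x - ((n : ℝ) + 1) + 1 + 1 = x - n + 1 by ring] at hG
    rw [show x - ((n : ℝ) + 1) - 1 = x - (n + 1 + 1) by ring] at h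
    rw [ih (by linarith), hG, kurepaP, eq_sub_of_add_eq h]
    ring

theorem kurepaR_mul_Gamma (n : ℕ) {x : ℝ} (hx : (n : ℝ) < x) :
    kurepaR (n + 1) x * Real.Gamma (x + 2) =
      (-1) ^ (n + 1) * (kurepaP n x * Real.Gamma (x - n + 1)) := by
  induction n using Nat.strong_induction_on with
  | _ n ih =>
    match n with
    | 0 =>
      push_cast at hx
      have h := Real.Gamma_add_one (s := x + 1) (by linarith)
      rw [show x + 1 + 1 = x + 2 by ring] at h
      have : x + 1 ≠ 0 := by linarith
      simp only [kurepaR, kurepaP, h, CharP.cast_eq_zero, sub_zero, zero_add, pow_one]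
      field_simp
    | 1 =>
      push_cast at hx
      have h := Real.Gamma_add_one (s := x + 1) (by linarith)
      have h' := Real.Gamma_add_one (s := x) (by linarith)
      rw [show x + 1 + 1 = x + 2 by ring] at h
      have h0 : x ≠ 0 := by linarith
      have h1 : x + 1 ≠ 0 := by linarith
      simp only [kurepaR, kurepaP, h, h', Nat.cast_one, sub_add_cancel, CharP.cast_eq_zero]
      field_simp
      ring
    | n + 2 =>
      push_cast at hx
      have e1 := ih (n + 1) (by lia) (by push_cast; linarith)
      have e2 := ih n (by lia) (by linarith)
      have hG := Real.Gamma_add_one (s := x - n) (by linarith)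
      have hG' := Real.Gamma_add_one (s := x - n - 1) (by linarith)
      have h0 : x - ((n : ℝ) + 3) + 2 ≠ 0 := by linarith
      rw [sub_add_cancel] at hG'
      push_cast at e1 ⊢
      rw [show x - ((n : ℝ) + 1) + 1 = x - n by ring] at e1
      rw [show x - ((n : ℝ) + 2) + 1 = x - n - 1 by ring]
      have p1 : kurepaP (n + 1) x = (x - n) * kurepaP n x + (-1) ^ (n + 1) := by
        rw [kurepaP]; ring
      have p2 : kurepaP (n + 2) x = (x - n - 1) * kurepaP (n + 1) x + (-1) ^ (n + 2) := by
        rw [kurepaP]; push_cast; ring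
      rw [kurepaR, add_mul, mul_assoc, mul_assoc, e1, e2, hG, hG', p2, p1]
      rcases neg_one_pow_eq_or ℝ n with h | h <;>
      · simp only [pow_succ, h]
        field_simp
        ring

/-- For each odd `k = 2n+1` and every real `x ≥ k+1`:
`(p_k(x)/(p_k(x)+1))·(−r_k(x)) ≤ F(x)/Γ(x+2) < −r_k(x)`, where the left inequality is an
equality iff `x = k+1`. -/
theorem reAltKurepa_div_gamma_bounds_odd (n : ℕ) (k : ℕ) (hk : k = 2 * n + 1)
    (x : ℝ) (hx : (k : ℝ) + 1 ≤ x) :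
    (kurepaP k x / (kurepaP k x + 1)) * (-(kurepaR k x)) ≤ reAltKurepa x / Real.Gamma (x + 2) ∧
    reAltKurepa x / Real.Gamma (x + 2) < -(kurepaR k x) ∧
    ((kurepaP k x / (kurepaP k x + 1)) * (-(kurepaR k x)) = reAltKurepa x / Real.Gamma (x + 2) ↔
      x = (k : ℝ) + 1) := by
  subst hk
  set k := 2 * n + 1 with hk
  have hodd : Odd k := ⟨n, hk⟩
  have hsign : (-1 : ℝ) ^ k = -1 := hodd.neg_one_pow
  have hcast : (k : ℝ) = ((2 * n : ℕ) : ℝ) + 1 := by rw [hk]; push_cast; ring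
  have hg : 0 < Real.Gamma (x - k + 1) := Real.Gamma_pos_of_pos (by linarith)
  have hΓ : 0 < Real.Gamma (x + 2) :=
    Real.Gamma_pos_of_pos (by have := k.cast_nonneg (α := ℝ); linarith)
  have hGamma := Real.Gamma_add_one (s := x - k + 1) (by linarith)
  have hP : kurepaP k x = (x - k + 1) * kurepaP (2 * n) x - 1 := by
    rw [hk, kurepaP, ← hk, hsign, hcast]
    ring
  have hR : -kurepaR k x * Real.Gamma (x + 2) =
      (kurepaP k x + 1) * Real.Gamma (x - k + 1) := by
    have h := kurepaR_mul_Gamma (2 * n) (x := x) (by linarith)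
    rw [← hk, hsign, show x - ((2 * n : ℕ) : ℝ) + 1 = x - k + 1 + 1 by rw [hcast]; ring,
      hGamma] at h
    rw [hP]
    linarith
  have hF : reAltKurepa x =
      kurepaP k x * Real.Gamma (x - k + 1) + reAltKurepa (x - (k + 1)) := by
    have h := reAltKurepa_eq_kurepaP_mul_Gamma_add k hx
    rwa [pow_succ, hsign, neg_one_mul, neg_neg, one_mul] at h
  have hstep : reAltKurepa (x - k) + reAltKurepa (x - (k + 1)) = Real.Gamma (x - k + 1) := by
    rw [← sub_sub]
    exact reAltKurepa_add_reAltKurepa_sub_one (by linarith)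
  have hpos : 0 < reAltKurepa (x - k) := reAltKurepa_pos (by linarith)
  have hnonneg : 0 ≤ reAltKurepa (x - (k + 1)) := reAltKurepa_nonneg (by linarith)
  have hFx : 0 < reAltKurepa x :=
    reAltKurepa_pos (by have := k.cast_nonneg (α := ℝ); linarith)
  have hP1 : 0 < kurepaP k x + 1 := pos_of_mul_pos_left
    (b := Real.Gamma (x - k + 1)) (by linarith) hg.le
  have hlower : kurepaP k x / (kurepaP k x + 1) * -kurepaR k x =
      kurepaP k x * Real.Gamma (x - k + 1) / Real.Gamma (x + 2) := by
    rw [eq_div_iff hΓ.ne', mul_assoc, hR]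
    field_simp
  rw [hlower]
  refine ⟨?_, ?_, ?_⟩
  · gcongr
    linarith
  · rw [div_lt_iff₀ hΓ, hR]
    linarith
  · rw [div_left_inj' hΓ.ne', hF, left_eq_add]
    constructor
    · intro h
      by_contra hne
      exact (reAltKurepa_pos (sub_pos.2 (lt_of_le_of_ne hx (Ne.symm hne)))).ne' h
    · rintro rfl
      rw [sub_self, reAltKurepa_zero]
end
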